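/- Let k ≥ 1 be an integer, V a finite set, d_max > 0 and d : V → [0, d_max] with d(V) ≥ 2k·d_max. For each k-subset e of V define w(e) := (k−1)!·(∏_{v∈e} d(v)) / d(V)^{k−1}. Then for every j ∈ {0,…,k} and every j-subset U of V, the total weight ∑_{e : U ⊆ e, |e| = k} w(e) equals (1 ± 4k² d_max/d(V)) · (k−1)!·(∏_{u∈U} d(u)) / ((k−j)!·d(V)^{j−1}). In particular, for every v ∈ V, ∑_{e : v ∈ e} w(e) = (1 ± 4k² d_max/d(V)) · d(v). -/

import Mathlib

open Finset

lemma aux_double {α : Type*} [DecidableEq α] (k : ℕ) (V U : Finset α) (hU : U ⊆ V)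
    (f : Finset α → ℝ) :
    ∑ v ∈ V \ U, ∑ e ∈ (V.powersetCard k).filter (fun e => insert v U ⊆ e), f e =
      ((k : ℝ) - U.card) * ∑ e ∈ (V.powersetCard k).filter (fun e => U ⊆ e), f e := by
  have h1 : ∀ v ∈ V \ U, ∑ e ∈ (V.powersetCard k).filter (fun e => insert v U ⊆ e), f e =
      ∑ e ∈ (V.powersetCard k).filter (fun e => U ⊆ e), if v ∈ e then f e else 0 := by
    intro v hv
    rw [← Finset.sum_filter, Finset.filter_filter]
    refine Finset.sum_congr ?_ fun _ _ => rfl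
    ext e
    simp only [Finset.mem_filter, Finset.insert_subset_iff]
    tauto
  rw [Finset.sum_congr rfl h1, Finset.sum_comm, Finset.mul_sum]
  refine Finset.sum_congr rfl fun e he => ?_
  simp only [Finset.mem_filter, Finset.mem_powersetCard] at he
  obtain ⟨⟨heV, hek⟩, hUe⟩ := he
  rw [← Finset.sum_filter, Finset.sum_const]
  have h2 : (V \ U).filter (fun v => v ∈ e) = e \ U := by
    ext x
    simp only [Finset.mem_filter, Finset.mem_sdiff]
    constructor
    · tauto
    · rintro ⟨a, b⟩; exact ⟨⟨heV a, b⟩, a⟩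
  rw [h2, Finset.card_sdiff_of_subset hUe, nsmul_eq_mul,
    Nat.cast_sub (Finset.card_le_card hUe), hek]

lemma aux_bounds {α : Type*} [DecidableEq α] (k : ℕ)
    (V : Finset α) (D : ℝ) (hD : 0 < D) (d : α → ℝ)
    (hd0 : ∀ v ∈ V, 0 ≤ d v) (hd1 : ∀ v ∈ V, d v ≤ D)
    (hsum : (k : ℝ) * D ≤ ∑ v ∈ V, d v) (m : ℕ) :
    ∀ U ⊆ V, U.card + m = k →
      ((∏ u ∈ U, d u) * (∑ v ∈ V, d v - k * D) ^ m ≤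
        (m.factorial : ℝ) * ∑ e ∈ (V.powersetCard k).filter (fun e => U ⊆ e), ∏ v ∈ e, d v) ∧
      ((m.factorial : ℝ) * ∑ e ∈ (V.powersetCard k).filter (fun e => U ⊆ e), ∏ v ∈ e, d v ≤
        (∏ u ∈ U, d u) * (∑ v ∈ V, d v) ^ m) := by
  induction m with
  | zero =>
    intro U hU hc
    have : (V.powersetCard k).filter (fun e => U ⊆ e) = {U} := by
      ext e
      simp only [Finset.mem_filter, Finset.mem_powersetCard, Finset.mem_singleton]
      constructor
      · rintro ⟨⟨_, h⟩, h2⟩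
        exact (Finset.eq_of_subset_of_card_le h2 (by omega)).symm
      · rintro rfl
        exact ⟨⟨hU, by omega⟩, subset_rfl⟩
    rw [this]
    simp
  | succ m ih =>
    intro U hU hc
    have hdc := aux_double k V U hU (fun e => ∏ v ∈ e, d v)
    set S := ∑ v ∈ V, d v with hS
    set P := ∏ u ∈ U, d u with hP
    have hP0 : 0 ≤ P := Finset.prod_nonneg fun u hu => hd0 u (hU hu)
    have hkj : (k : ℝ) - U.card = (m : ℝ) + 1 := by
      rw [← hc]; push_cast; ring
    rw [hkj] at hdc
    have hsplit : ∑ v ∈ V \ U, d v + ∑ v ∈ U, d v = S := Finset.sum_sdiff hU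
    have hU0 : 0 ≤ ∑ v ∈ U, d v := Finset.sum_nonneg fun u hu => hd0 u (hU hu)
    have hU1 : ∑ v ∈ U, d v ≤ k * D := by
      calc ∑ v ∈ U, d v ≤ U.card • D := Finset.sum_le_card_nsmul _ _ _ fun u hu => hd1 u (hU hu)
        _ = U.card * D := nsmul_eq_mul _ _
        _ ≤ k * D := by
          have : (U.card : ℝ) ≤ k := by exact_mod_cast (by omega)
          gcongr
    have hS0 : 0 ≤ S := Finset.sum_nonneg hd0
    have hins : ∀ v ∈ V \ U, insert v U ⊆ V ∧ (insert v U).card + m = k ∧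
        ∏ u ∈ insert v U, d u = d v * P := by
      intro v hv
      rw [Finset.mem_sdiff] at hv
      refine ⟨Finset.insert_subset hv.1 hU, ?_, Finset.prod_insert hv.2⟩
      rw [Finset.card_insert_of_notMem hv.2]; omega
    have hf : (((m + 1).factorial : ℕ) : ℝ) = ((m : ℝ) + 1) * m.factorial := by
      rw [Nat.factorial_succ]; push_cast; ring
    rw [hf, mul_comm ((m : ℝ) + 1), mul_assoc, ← hdc, Finset.mul_sum]
    constructor
    · calc P * (S - k * D) ^ (m + 1) = (S - k * D) * (P * (S - k * D) ^ m) := by ring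
        _ ≤ (∑ v ∈ V \ U, d v) * (P * (S - k * D) ^ m) := by
          have : 0 ≤ S - k * D := by linarith
          refine mul_le_mul_of_nonneg_right (by linarith) (by positivity)
        _ ≤ _ := by
          rw [Finset.sum_mul]
          refine Finset.sum_le_sum fun v hv => ?_
          obtain ⟨h1, h2, h3⟩ := hins v hv
          have := (ih _ h1 h2).1
          rw [h3] at this
          linarith
    · calc _ ≤ ∑ v ∈ V \ U, d v * (P * S ^ m) := by
            refine Finset.sum_le_sum fun v hv => ?_
            obtain ⟨h1, h2, h3⟩ := hins v hv
            have := (ih _ h1 h2).2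
            rw [h3] at this
            linarith
        _ = (∑ v ∈ V \ U, d v) * (P * S ^ m) := by rw [Finset.sum_mul]
        _ ≤ S * (P * S ^ m) := mul_le_mul_of_nonneg_right (by linarith) (by positivity)
        _ = P * S ^ (m + 1) := by ring

theorem stmt_1 {α : Type*} [DecidableEq α] (k : ℕ) (hk : 1 ≤ k)
    (V : Finset α) (dmax : ℝ) (hdmax : 0 < dmax) (d : α → ℝ)
    (hd0 : ∀ v ∈ V, 0 ≤ d v) (hd1 : ∀ v ∈ V, d v ≤ dmax)
    (hsum : 2 * (k : ℝ) * dmax ≤ ∑ v ∈ V, d v) :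
    (∀ j : ℕ, j ≤ k → ∀ U ∈ V.powersetCard j,
      ((1 - 4 * (k : ℝ) ^ 2 * dmax / ∑ v ∈ V, d v) *
          (((Nat.factorial (k-1) : ℝ) * ∏ u ∈ U, d u) /
            ((Nat.factorial (k-j) : ℝ) * (∑ v ∈ V, d v) ^ ((j : ℤ) - 1))) ≤
        ∑ e ∈ (V.powersetCard k).filter (fun e => U ⊆ e),
          ((Nat.factorial (k-1) : ℝ) * ∏ v ∈ e, d v) / (∑ v ∈ V, d v) ^ (k - 1)) ∧
      (∑ e ∈ (V.powersetCard k).filter (fun e => U ⊆ e),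
          ((Nat.factorial (k-1) : ℝ) * ∏ v ∈ e, d v) / (∑ v ∈ V, d v) ^ (k - 1) ≤
        (1 + 4 * (k : ℝ) ^ 2 * dmax / ∑ v ∈ V, d v) *
          (((Nat.factorial (k-1) : ℝ) * ∏ u ∈ U, d u) /
            ((Nat.factorial (k-j) : ℝ) * (∑ v ∈ V, d v) ^ ((j : ℤ) - 1))))) ∧
    (∀ v ∈ V,
      ((1 - 4 * (k : ℝ) ^ 2 * dmax / ∑ u ∈ V, d u) * d v ≤
        ∑ e ∈ (V.powersetCard k).filter (fun e => v ∈ e),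
          ((Nat.factorial (k-1) : ℝ) * ∏ u ∈ e, d u) / (∑ u ∈ V, d u) ^ (k - 1)) ∧
      (∑ e ∈ (V.powersetCard k).filter (fun e => v ∈ e),
          ((Nat.factorial (k-1) : ℝ) * ∏ u ∈ e, d u) / (∑ u ∈ V, d u) ^ (k - 1) ≤
        (1 + 4 * (k : ℝ) ^ 2 * dmax / ∑ u ∈ V, d u) * d v)) := by
  have hk1 : (1 : ℝ) ≤ k := by exact_mod_cast hk
  have hkD : 0 < (k : ℝ) * dmax := by positivity
  have hS : 0 < ∑ v ∈ V, d v := by linarith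
  have hB := aux_bounds k V dmax hdmax d hd0 hd1 (by linarith)
  have main : ∀ j : ℕ, j ≤ k → ∀ U ∈ V.powersetCard j,
      ((1 - 4 * (k : ℝ) ^ 2 * dmax / ∑ v ∈ V, d v) *
          (((Nat.factorial (k-1) : ℝ) * ∏ u ∈ U, d u) /
            ((Nat.factorial (k-j) : ℝ) * (∑ v ∈ V, d v) ^ ((j : ℤ) - 1))) ≤
        ∑ e ∈ (V.powersetCard k).filter (fun e => U ⊆ e),
          ((Nat.factorial (k-1) : ℝ) * ∏ v ∈ e, d v) / (∑ v ∈ V, d v) ^ (k - 1)) ∧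
      (∑ e ∈ (V.powersetCard k).filter (fun e => U ⊆ e),
          ((Nat.factorial (k-1) : ℝ) * ∏ v ∈ e, d v) / (∑ v ∈ V, d v) ^ (k - 1) ≤
        (1 + 4 * (k : ℝ) ^ 2 * dmax / ∑ v ∈ V, d v) *
          (((Nat.factorial (k-1) : ℝ) * ∏ u ∈ U, d u) /
            ((Nat.factorial (k-j) : ℝ) * (∑ v ∈ V, d v) ^ ((j : ℤ) - 1)))) := by
    intro j hj U hU
    rw [Finset.mem_powersetCard] at hU
    obtain ⟨hUV, hUc⟩ := hU
    obtain ⟨hlo, hup⟩ := hB (k - j) U hUV (by omega)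
    rw [← Finset.sum_div, ← Finset.mul_sum]
    have hP0 : 0 ≤ ∏ u ∈ U, d u := Finset.prod_nonneg fun u hu => hd0 u (hUV hu)
    generalize (∑ e ∈ (V.powersetCard k).filter (fun e => U ⊆ e), ∏ v ∈ e, d v) = F at *
    generalize (∏ u ∈ U, d u) = P at *
    generalize (∑ v ∈ V, d v) = S at *
    have hpow : S ^ (k - 1) = S ^ ((j : ℤ) - 1) * S ^ (k - j) := by
      rw [← zpow_natCast S (k - 1), ← zpow_natCast S (k - j), ← zpow_add₀ hS.ne']
      congr 1
      omega
    have hA : 0 < S ^ ((j : ℤ) - 1) := zpow_pos hS _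
    have hM : 0 < S ^ (k - j) := pow_pos hS _
    have hm : (((k - j : ℕ)) : ℝ) ≤ k := by exact_mod_cast Nat.sub_le k j
    have hx0 : 0 ≤ dmax / S := by positivity
    have hbern : (1 - 4 * (k : ℝ) ^ 2 * dmax / S) * S ^ (k - j) ≤ (S - k * dmax) ^ (k - j) := by
      have e1 : (S - k * dmax) = (1 + -(k * (dmax / S))) * S := by field_simp; ring
      have hle : k * (dmax / S) ≤ 1 := by
        rw [← mul_div_assoc, div_le_one hS]; linarith
      rw [e1, mul_pow]
      refine mul_le_mul_of_nonneg_right ?_ hM.le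
      have b := one_add_mul_le_pow (a := -(k * (dmax / S))) (by linarith) (k - j)
      have e2 : 4 * (k : ℝ) ^ 2 * dmax / S = 4 * (k * (k * (dmax / S))) := by ring
      have e3 : ((k - j : ℕ) : ℝ) * (k * (dmax / S)) ≤ k * (k * (dmax / S)) :=
        mul_le_mul_of_nonneg_right hm (by positivity)
      have e4 : 0 ≤ k * (k * (dmax / S)) := by positivity
      linarith
    have hx : 0 ≤ 4 * (k : ℝ) ^ 2 * dmax / S := by positivity
    generalize 4 * (k : ℝ) ^ 2 * dmax / S = x at *
    have hlo' : (1 - x) * S ^ (k - j) * P ≤ (k - j).factorial * F := by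
      have := mul_le_mul_of_nonneg_left hbern hP0
      linarith
    have hup' : (k - j).factorial * F ≤ (1 + x) * S ^ (k - j) * P := by
      have : 0 ≤ x * (P * S ^ (k - j)) := by positivity
      linarith
    have hf : (0 : ℝ) < (k - j).factorial := by positivity
    have hg : (0 : ℝ) < (k - 1).factorial := by positivity
    rw [hpow]
    generalize ((k - j).factorial : ℝ) = f at *
    generalize ((k - 1).factorial : ℝ) = g at *
    generalize S ^ ((j : ℤ) - 1) = A at *
    generalize S ^ (k - j) = M at *
    have r1 : g * F / (A * M) = (f * F) * (g / (f * A * M)) := by field_simp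
    have r2 : ∀ c : ℝ, c * (g * P / (f * A)) = (c * M * P) * (g / (f * A * M)) := by
      intro c; field_simp
    rw [r1, r2, r2]
    exact ⟨mul_le_mul_of_nonneg_right hlo' (by positivity),
      mul_le_mul_of_nonneg_right hup' (by positivity)⟩
  refine ⟨main, fun v hv => ?_⟩
  have h := main 1 hk {v} (by simp [Finset.mem_powersetCard, hv])
  have hg : ((k - 1).factorial : ℝ) ≠ 0 := by positivity
  have e : ((k - 1).factorial : ℝ) * (∏ u ∈ {v}, d u) /
      (((k - 1).factorial : ℝ) * (∑ v ∈ V, d v) ^ (((1 : ℕ) : ℤ) - 1)) = d v := by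
    simp [hg]
  rw [e] at h
  simpa only [Finset.singleton_subset_iff] using h
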